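/- arXiv:2105.10681 — 2 statements merged into one kernel-verified Lean document; each statement's English description precedes it below -/
import Mathlib

section
/- Let X be a real Banach space having no non-trivial infratype, i.e. for every p > 1 and every C > 0, X fails to have infratype p with constant C. Then there exists a multifunction F : [0,1] → (nonempty bounded subsets of X) such that conv F : t ↦ conv(F(t)) is Riemann integrable, but F is not Riemann integrable. -/
open Pointwise

/-- A tagged partition of the interval `[0,1]`: subdivision points
`x 0 = 0 ≤ x 1 ≤ … ≤ x n = 1` together with tags `t i ∈ [x i, x (i+1)]`. -/
structure TaggedPartition where
  n : ℕ
  npos : 0 < n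
  x : Fin (n + 1) → ℝ
  t : Fin n → ℝ
  mono : Monotone x
  x_zero : x 0 = 0
  x_last : x (Fin.last n) = 1
  tag_mem : ∀ i : Fin n, t i ∈ Set.Icc (x i.castSucc) (x i.succ)

/-- The mesh `d(T)` of a tagged partition: the largest length of a subinterval. -/
noncomputable def TaggedPartition.mesh (T : TaggedPartition) : ℝ :=
  ⨆ i : Fin T.n, (T.x i.succ - T.x i.castSucc)

/-- The Riemann sum `S(F,T) = ∑ |Δ i| • F (t i)` of a multifunction `F`,
where the sum of sets is the Minkowski sum. -/
noncomputable def setRiemannSum {X : Type*} [NormedAddCommGroup X] [NormedSpace ℝ X]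
    (F : ℝ → Set X) (T : TaggedPartition) : Set X :=
  ∑ i : Fin T.n, (T.x i.succ - T.x i.castSucc) • F (T.t i)

/-- A closed bounded nonempty set `A` is the Riemann integral of the multifunction `F` if
the Riemann sums of `F` converge to `A` in the Hausdorff distance as the mesh tends to `0`. -/
def IsSetRiemannIntegral {X : Type*} [NormedAddCommGroup X] [NormedSpace ℝ X]
    (F : ℝ → Set X) (A : Set X) : Prop :=
  A.Nonempty ∧ IsClosed A ∧ Bornology.IsBounded A ∧
    ∀ ε > 0, ∃ δ > 0, ∀ T : TaggedPartition, T.mesh < δ →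
      Metric.hausdorffDist (setRiemannSum F T) A < ε

/-- A multifunction is Riemann integrable if it has a Riemann integral. -/
def SetRiemannIntegrable {X : Type*} [NormedAddCommGroup X] [NormedSpace ℝ X]
    (F : ℝ → Set X) : Prop :=
  ∃ A : Set X, IsSetRiemannIntegral F A

/-- `F` is a multifunction on `[0,1]` with nonempty bounded values. -/
def IsMultifunction {X : Type*} [NormedAddCommGroup X] (F : ℝ → Set X) : Prop :=
  ∀ t ∈ Set.Icc (0 : ℝ) 1, (F t).Nonempty ∧ Bornology.IsBounded (F t)

/-- `X` has infratype `p` with constant `C`: for every finite collection of vectors one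
can choose signs `±1` so that `‖∑ αᵢ xᵢ‖ ≤ C (∑ ‖xᵢ‖^p)^{1/p}`. -/
def HasInfratype (X : Type*) [NormedAddCommGroup X] [NormedSpace ℝ X] (p C : ℝ) : Prop :=
  ∀ (n : ℕ) (x : Fin n → X), ∃ α : Fin n → ℝ, (∀ i, α i = 1 ∨ α i = -1) ∧
    ‖∑ i, α i • x i‖ ≤ C * (∑ i, ‖x i‖ ^ p) ^ (1 / p)

lemma sum_le_of_card_band_lt {ι : Type*} {n : ℕ} {ρ : ℝ} (hρ0 : 0 < ρ) (hρ1 : ρ < 1) (a : ι → ℝ)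
    (s : Finset ι)
    (hs : ∀ M > 0, ∀ t ⊆ s, (∀ i ∈ t, ρ * M < a i ∧ a i ≤ M) → t.card ≤ n)
    (M : ℝ) (hM : 0 ≤ M) (ha : ∀ i ∈ s, 0 ≤ a i ∧ a i ≤ M) :
    ∑ i ∈ s, a i ≤ n / (1 - ρ) * M := by
  classical
  induction s using Finset.strongInduction generalizing M with
  | H s ih =>
    have hC : 0 ≤ n / (1 - ρ) := div_nonneg n.cast_nonneg (by linarith)
    rcases s.eq_empty_or_nonempty with rfl | hne
    · simpa using mul_nonneg hC hM
    obtain ⟨i₀, hi₀, hmax⟩ := s.exists_max_image a hne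
    rcases (ha i₀ hi₀).1.eq_or_lt with h0 | hpos
    · calc ∑ i ∈ s, a i ≤ ∑ i ∈ s, 0 := Finset.sum_le_sum fun i hi => h0 ▸ hmax i hi
        _ ≤ _ := by simpa using mul_nonneg hC hM
    · set m := a i₀ with hm
      have hρm : ρ * m < m := by nlinarith
      have hlow : ∑ i ∈ s with ¬ ρ * m < a i, a i ≤ n / (1 - ρ) * (ρ * m) := by
        refine ih _ ?_ (fun M' hM' t ht => hs M' hM' t (ht.trans (Finset.filter_subset _ _))) _
          (by positivity) ?_
        · refine Finset.filter_ssubset.2 ⟨i₀, hi₀, not_not.2 hρm⟩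
        · intro i hi
          rw [Finset.mem_filter, not_lt] at hi
          exact ⟨(ha i hi.1).1, hi.2⟩
      have hhigh : ∑ i ∈ s with ρ * m < a i, a i ≤ n * m := by
        have hcard : (s.filter fun i => ρ * m < a i).card ≤ n := by
          refine hs m hpos _ (Finset.filter_subset _ _) fun i hi => ?_
          rw [Finset.mem_filter] at hi
          exact ⟨hi.2, hmax i hi.1⟩
        calc ∑ i ∈ s with ρ * m < a i, a i ≤ (s.filter fun i => ρ * m < a i).card • m :=
              Finset.sum_le_card_nsmul _ _ _ fun i hi => hmax i (Finset.mem_filter.1 hi).1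
          _ ≤ n * m := by
              rw [nsmul_eq_mul]
              gcongr
      calc ∑ i ∈ s, a i ≤ n * m + n / (1 - ρ) * (ρ * m) := by
            rw [← Finset.sum_filter_add_sum_filter_not s fun i => ρ * m < a i]
            exact add_le_add hhigh hlow
        _ = n / (1 - ρ) * m := by
            have : 1 - ρ ≠ 0 := by linarith
            field_simp
            ring
        _ ≤ n / (1 - ρ) * M := mul_le_mul_of_nonneg_left (ha i₀ hi₀).2 hC

lemma exists_signs_norm_le {X ι : Type*} [NormedAddCommGroup X] [NormedSpace ℝ X]
    {n : ℕ} (hn : 2 ≤ n) {θ ρ p : ℝ} (hθ : 0 ≤ θ) (hρ0 : 0 < ρ) (hρ1 : ρ < 1) (hp : 0 < p)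
    (hθρ : (θ * n) ^ p ≤ n * ρ ^ p)
    (H : ∀ (t : Finset ι) (x : ι → X) (M : ℝ), 0 < M → t.card = n → (∀ i ∈ t, ‖x i‖ ≤ M) →
      ∃ α : ι → ℝ, (∀ i, α i = 1 ∨ α i = -1) ∧ ‖∑ i ∈ t, α i • x i‖ ≤ θ * n * M)
    (s : Finset ι) (x : ι → X) (R : ℝ) (hR : 0 ≤ R) (hx : ∑ i ∈ s, ‖x i‖ ^ p ≤ R ^ p) :
    ∃ α : ι → ℝ, (∀ i, α i = 1 ∨ α i = -1) ∧ ‖∑ i ∈ s, α i • x i‖ ≤ n / (1 - ρ) * R := by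
  classical
  induction hm : s.card using Nat.strong_induction_on generalizing s x with
  | _ m ih =>
  by_cases hband : ∃ M > 0, ∃ t ⊆ s, t.card = n ∧ ∀ i ∈ t, ρ * M < ‖x i‖ ∧ ‖x i‖ ≤ M
  · obtain ⟨M, hM, t, hts, htn, ht⟩ := hband
    obtain ⟨α, hα, hαle⟩ := H t x M hM htn fun i hi => (ht i hi).2
    obtain ⟨i₀, hi₀⟩ : t.Nonempty := Finset.card_pos.1 (by omega)
    set y := ∑ i ∈ t, α i • x i with hy
    have hnot : i₀ ∉ s \ t := by simp [hi₀]
    have hupd : ∀ i ∈ s \ t, Function.update x i₀ y i = x i := fun i hi =>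
      Function.update_of_ne (by rintro rfl; exact hnot hi) _ _
    have hyp : ‖y‖ ^ p ≤ ∑ i ∈ t, ‖x i‖ ^ p := by
      calc ‖y‖ ^ p ≤ (θ * n * M) ^ p := Real.rpow_le_rpow (norm_nonneg _) hαle hp.le
        _ = (θ * n) ^ p * M ^ p := Real.mul_rpow (by positivity) hM.le
        _ ≤ n * ρ ^ p * M ^ p := by gcongr
        _ = t.card • (ρ * M) ^ p := by
            rw [Real.mul_rpow hρ0.le hM.le, nsmul_eq_mul, htn]
            ring
        _ ≤ ∑ i ∈ t, ‖x i‖ ^ p := Finset.card_nsmul_le_sum _ _ _ fun i hi =>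
            Real.rpow_le_rpow (by positivity) (ht i hi).1.le hp.le
    have hcard : (insert i₀ (s \ t)).card < m := by
      rw [Finset.card_insert_of_notMem hnot, Finset.card_sdiff_of_subset hts]
      have := Finset.card_le_card hts
      omega
    obtain ⟨β, hβ, hβle⟩ := ih _ hcard (insert i₀ (s \ t)) (Function.update x i₀ y) (by
      rw [Finset.sum_insert hnot, Function.update_self,
        Finset.sum_congr rfl fun i hi => by rw [hupd i hi]]
      rw [← Finset.sum_sdiff hts] at hx
      linarith) rfl
    refine ⟨fun i => if i ∈ t then β i₀ * α i else β i, fun i => ?_, ?_⟩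
    · dsimp only
      split_ifs
      · rcases hβ i₀ with h | h <;> rcases hα i with h' | h' <;> simp [h, h']
      · exact hβ i
    · convert hβle using 2
      rw [Finset.sum_insert hnot, Function.update_self, ← Finset.sum_sdiff hts, add_comm, hy,
        Finset.smul_sum]
      congr 1
      · exact Finset.sum_congr rfl fun i hi => by simp [hi, mul_smul]
      · refine Finset.sum_congr rfl fun i hi => ?_
        rw [← hy, hupd i hi]
        simp [(Finset.mem_sdiff.1 hi).2]
  · refine ⟨fun _ => 1, fun _ => Or.inl rfl, ?_⟩
    refine (norm_sum_le _ _).trans ?_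
    simp only [one_smul]
    refine sum_le_of_card_band_lt hρ0 hρ1 (fun i => ‖x i‖) s ?_ R hR fun i hi =>
      ⟨norm_nonneg _, ?_⟩
    · intro M hM t hts ht
      by_contra! hlt
      obtain ⟨u, hut, hun⟩ := Finset.exists_subset_card_eq hlt.le
      exact hband ⟨M, hM, u, hut.trans hts, hun, fun i hi => ht i (hut hi)⟩
    · refine (Real.rpow_le_rpow_iff (norm_nonneg _) hR hp).1 (le_trans ?_ hx)
      exact Finset.single_le_sum (f := fun i => ‖x i‖ ^ p) (fun j _ => by positivity) hi

lemma exists_rpow_mul_le {n θ ρ : ℝ} (hn : 0 < n) (hθ : 0 < θ) (hθρ : θ < ρ) :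
    ∃ p : ℝ, 1 < p ∧ (θ * n) ^ p ≤ n * ρ ^ p := by
  have h1 : Filter.Tendsto (fun p : ℝ => (θ * n) ^ p) (nhdsWithin 1 (Set.Ioi 1))
      (nhds (θ * n)) := by
    have : Continuous fun p : ℝ => (θ * n) ^ p :=
      Real.continuous_const_rpow (mul_pos hθ hn).ne'
    simpa using (this.tendsto 1).mono_left nhdsWithin_le_nhds
  have h2 : Filter.Tendsto (fun p : ℝ => n * ρ ^ p) (nhdsWithin 1 (Set.Ioi 1))
      (nhds (n * ρ)) := by
    have : Continuous fun p : ℝ => n * ρ ^ p :=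
      continuous_const.mul (Real.continuous_const_rpow (hθ.trans hθρ).ne')
    simpa using (this.tendsto 1).mono_left nhdsWithin_le_nhds
  have hlt : θ * n < n * ρ := by nlinarith
  obtain ⟨p, hp, hp1⟩ := ((h1.eventually_lt h2 hlt).and self_mem_nhdsWithin).exists
  exact ⟨p, hp1, hp.le⟩

/-- Without nontrivial infratype there are unit-ball vectors all of whose signed sums are almost
as long as the triangle inequality allows. -/
lemma exists_forall_signs_lt_norm {X : Type*} [NormedAddCommGroup X] [NormedSpace ℝ X]
    (hX : ∀ p C : ℝ, 1 < p → 0 < C → ¬ HasInfratype X p C) {n : ℕ} (hn : 2 ≤ n)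
    {θ : ℝ} (hθ0 : 0 < θ) (hθ1 : θ < 1) :
    ∃ x : Fin n → X, (∀ i, ‖x i‖ ≤ 1) ∧
      ∀ α : Fin n → ℝ, (∀ i, α i = 1 ∨ α i = -1) → θ * n < ‖∑ i, α i • x i‖ := by
  by_contra! hcon
  obtain ⟨ρ, hθρ, hρ1⟩ := exists_between hθ1
  obtain ⟨p, hp, hpn⟩ := exists_rpow_mul_le (n := (n : ℝ)) (by positivity) hθ0 hθρ
  have hC : 0 < n / (1 - ρ) := div_pos (by positivity) (by linarith)
  refine hX p _ hp hC fun m x => ?_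
  have hS : 0 ≤ ∑ i, ‖x i‖ ^ p := Finset.sum_nonneg fun i _ => by positivity
  refine exists_signs_norm_le hn hθ0.le (hθ0.trans hθρ) hρ1 (by linarith) hpn ?_ Finset.univ x
    _ (by positivity) ?_
  · intro t z M hM ht hz
    let e : Fin n ≃ t := (t.equivFinOfCardEq ht).symm
    obtain ⟨α, hα, hle⟩ := hcon (fun i => M⁻¹ • z (e i)) fun i => by
      rw [norm_smul, norm_inv, Real.norm_of_nonneg hM.le, inv_mul_le_iff₀ hM, mul_one]
      exact hz _ (e i).2
    refine ⟨fun j => if h : j ∈ t then α (e.symm ⟨j, h⟩) else 1, fun j => ?_, ?_⟩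
    · dsimp only
      split_ifs
      exacts [hα _, Or.inl rfl]
    · have : ∑ i, α i • M⁻¹ • z (e i) = M⁻¹ • ∑ j ∈ t,
          (if h : j ∈ t then α (e.symm ⟨j, h⟩) else 1) • z j := by
        rw [← Finset.sum_coe_sort t, Finset.smul_sum, ← e.sum_comp]
        refine Finset.sum_congr rfl fun i _ => ?_
        rw [dif_pos (e i).2, smul_comm]
        simp
      rw [this, norm_smul, norm_inv, Real.norm_of_nonneg hM.le, inv_mul_le_iff₀ hM] at hle
      linarith
  · rw [← Real.rpow_mul hS, one_div, inv_mul_cancel₀ (by linarith), Real.rpow_one]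

lemma sum_abs_le_two_mul_norm_sum {X ι : Type*} [NormedAddCommGroup X] [NormedSpace ℝ X]
    [Fintype ι] {θ : ℝ} (hθ : (1 - θ) * Fintype.card ι ≤ 1 / 2) (x : ι → X) (hx : ∀ i, ‖x i‖ ≤ 1)
    (hsign : ∀ α : ι → ℝ, (∀ i, α i = 1 ∨ α i = -1) → θ * Fintype.card ι < ‖∑ i, α i • x i‖)
    (c : ι → ℝ) : ∑ i, |c i| ≤ 2 * ‖∑ i, c i • x i‖ := by
  classical
  set M := ∑ i, |c i| with hM
  have hM0 : 0 ≤ M := Finset.sum_nonneg fun i _ => abs_nonneg _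
  have hcM : ∀ i, |c i| ≤ M := fun i =>
    Finset.single_le_sum (f := fun i => |c i|) (fun j _ => abs_nonneg _) (Finset.mem_univ i)
  let α : ι → ℝ := fun i => if 0 ≤ c i then 1 else -1
  have hα : ∀ i, α i = 1 ∨ α i = -1 := fun i => by simp only [α]; split_ifs <;> simp
  have hα' : ∀ i, |M * α i - c i| = M - |c i| := fun i => by
    have h := hcM i
    simp only [α]
    split_ifs with h0
    · rw [abs_of_nonneg h0] at h ⊢
      rw [abs_of_nonneg] <;> linarith
    · rw [abs_of_neg (not_le.1 h0)] at h ⊢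
      rw [abs_of_nonpos] <;> linarith
  have hsum : M • ∑ i, α i • x i = ∑ i, c i • x i + ∑ i, (M * α i - c i) • x i := by
    rw [← Finset.sum_add_distrib, Finset.smul_sum]
    refine Finset.sum_congr rfl fun i _ => ?_
    module
  have herr : ‖∑ i, (M * α i - c i) • x i‖ ≤ Fintype.card ι * M - M := by
    calc ‖∑ i, (M * α i - c i) • x i‖ ≤ ∑ i, (M - |c i|) := by
          refine norm_sum_le_of_le _ fun i _ => ?_
          rw [norm_smul, Real.norm_eq_abs, hα']
          exact mul_le_of_le_one_right (sub_nonneg.2 (hcM i)) (hx i)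
      _ = _ := by simp [Finset.sum_sub_distrib, hM]
  have hlow : M * (θ * Fintype.card ι) ≤ ‖M • ∑ i, α i • x i‖ := by
    rw [norm_smul, Real.norm_of_nonneg hM0]
    exact mul_le_mul_of_nonneg_left (hsign α hα).le hM0
  rw [hsum] at hlow
  have htri := norm_add_le (∑ i, c i • x i) (∑ i, (M * α i - c i) • x i)
  nlinarith

lemma exists_sum_abs_eq_one_of_card_lt {X : Type*} [NormedAddCommGroup X] [NormedSpace ℝ X]
    (Φ : Finset (X →L[ℝ] ℝ)) {d : ℕ} (hd : Φ.card < d) (z : Fin d → X) :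
    ∃ a : Fin d → ℝ, ∑ j, |a j| = 1 ∧ ∀ f ∈ Φ, f (∑ j, a j • z j) = 0 := by
  let L : (Fin d → ℝ) →ₗ[ℝ] (Φ → ℝ) :=
    LinearMap.pi fun f => (f : X →L[ℝ] ℝ).toLinearMap ∘ₗ Fintype.linearCombination ℝ z
  have hker : LinearMap.ker L ≠ ⊥ := L.ker_ne_bot_of_finrank_lt (by simpa using hd)
  obtain ⟨a, haL, ha⟩ := (Submodule.ne_bot_iff _).1 hker
  have hpos : 0 < ∑ j, |a j| := by
    refine (Finset.sum_nonneg fun j _ => abs_nonneg _).lt_of_ne fun h => ha ?_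
    ext j
    have := (Finset.sum_eq_zero_iff_of_nonneg fun j _ => abs_nonneg (a j)).1 h.symm j
    simpa using this
  refine ⟨fun j => (∑ j, |a j|)⁻¹ * a j, ?_, fun f hf => ?_⟩
  · simp only [abs_mul, ← Finset.mul_sum, abs_inv, abs_of_pos hpos]
    exact inv_mul_cancel₀ hpos.ne'
  · have h0 : f (∑ j, a j • z j) = 0 := by
      have := congrFun (LinearMap.mem_ker.1 haL) ⟨f, hf⟩
      simpa [L, Fintype.linearCombination_apply] using this
    simp only [mul_smul, ← Finset.smul_sum, map_smul, h0, smul_zero]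

/-- Without nontrivial infratype, copies of `ℓ₁ᴺ` exist inside every finite-codimensional
subspace, with a uniform isomorphism constant. -/
lemma exists_l1_family {X : Type*} [NormedAddCommGroup X] [NormedSpace ℝ X]
    (hX : ∀ p C : ℝ, 1 < p → 0 < C → ¬ HasInfratype X p C) (Φ : Finset (X →L[ℝ] ℝ))
    {N : ℕ} (hN : 2 ≤ N) :
    ∃ x : ℕ → X, (∀ i, ‖x i‖ ≤ 1) ∧ (∀ f ∈ Φ, ∀ i, f (x i) = 0) ∧
      ∀ c : ℕ → ℝ, ∑ i ∈ Finset.range N, |c i| ≤ 2 * ‖∑ i ∈ Finset.range N, c i • x i‖ := by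
  obtain ⟨d, hd⟩ : ∃ d, Φ.card < d := ⟨_, Nat.lt_succ_self _⟩
  have hNd : 2 ≤ N * d := by nlinarith [Nat.zero_le Φ.card]
  have hNd' : (2 : ℝ) ≤ (N * d : ℕ) := by exact_mod_cast hNd
  have hinv : 1 / (2 * ((N * d : ℕ) : ℝ)) ≤ 1 / 4 :=
    one_div_le_one_div_of_le (by norm_num) (by linarith)
  have hinv0 : 0 < 1 / (2 * ((N * d : ℕ) : ℝ)) := by positivity
  obtain ⟨z, hz, hsign⟩ := exists_forall_signs_lt_norm hX hNd
    (θ := 1 - 1 / (2 * ((N * d : ℕ) : ℝ))) (by linarith) (by linarith)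
  have hl1 := sum_abs_le_two_mul_norm_sum (by
    rw [Fintype.card_fin, sub_sub_cancel, one_div_mul_eq_div]
    exact (div_mul_cancel_right₀ (by linarith) 2).trans_le (by norm_num)) z hz (by simpa using hsign)
  choose a ha hΦ using fun i : Fin N =>
    exists_sum_abs_eq_one_of_card_lt Φ hd fun j => z (finProdFinEquiv (i, j))
  refine ⟨fun i => if h : i < N then ∑ j, a ⟨i, h⟩ j • z (finProdFinEquiv (⟨i, h⟩, j)) else 0,
    fun i => ?_, fun f hf i => ?_, fun c => ?_⟩
  · dsimp only
    split_ifs with h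
    · rw [← ha ⟨i, h⟩]
      refine norm_sum_le_of_le _ fun j _ => ?_
      rw [norm_smul, Real.norm_eq_abs]
      exact mul_le_of_le_one_right (abs_nonneg _) (hz _)
    · simp
  · dsimp only
    split_ifs with h
    · exact hΦ ⟨i, h⟩ f hf
    · simp
  · rw [Finset.sum_range, Finset.sum_range]
    have h := hl1 fun q => c (finProdFinEquiv.symm q).1 *
      a (finProdFinEquiv.symm q).1 (finProdFinEquiv.symm q).2
    rw [← finProdFinEquiv.sum_comp, ← finProdFinEquiv.sum_comp] at h
    simp only [Equiv.symm_apply_apply, Fintype.sum_prod_type, abs_mul, ← Finset.mul_sum, ha,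
      mul_one, mul_smul, ← Finset.smul_sum] at h
    simpa using h

lemma exists_finset_dual_norm_le_two_mul {X : Type*} [NormedAddCommGroup X] [NormedSpace ℝ X]
    (E : Submodule ℝ X) [FiniteDimensional ℝ E] :
    ∃ Φ : Finset (X →L[ℝ] ℝ), ∀ e ∈ E, ∀ w, (∀ f ∈ Φ, f w = 0) → ‖e‖ ≤ 2 * ‖e + w‖ := by
  classical
  choose g hg1 hg using fun u : X => exists_dual_vector'' ℝ u
  have : ProperSpace E := FiniteDimensional.proper_real E
  obtain ⟨t, -, ht⟩ := (isCompact_sphere (0 : E) 1).elim_nhds_subcover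
    (fun u : E => {v : E | 1 / 2 < g u v}) fun u hu => by
      have hu1 : ‖(u : X)‖ = 1 := by simpa using hu
      refine IsOpen.mem_nhds (isOpen_lt continuous_const (by fun_prop)) ?_
      have := hg (u : X)
      simp only [Set.mem_ofPred_eq, this, hu1]
      norm_num
  refine ⟨t.image fun u : E => g u, fun e he w hw => ?_⟩
  rcases eq_or_ne e 0 with rfl | he0
  · simp
  have hpos : 0 < ‖e‖ := norm_pos_iff.2 he0
  have hmem : (‖e‖⁻¹ • ⟨e, he⟩ : E) ∈ Metric.sphere (0 : E) 1 := by
    simp [norm_smul, hpos.ne']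
  obtain ⟨u, hut, hu⟩ := Set.mem_iUnion₂.1 (ht hmem)
  have hu' : 1 / 2 < ‖e‖⁻¹ * g u e := by simpa using hu
  have hgw : g u w = 0 := hw _ (Finset.mem_image_of_mem (fun u : E => g u) hut)
  have h1 : g u e ≤ ‖e + w‖ := by
    calc g u e = g u (e + w) := by rw [map_add, hgw, add_zero]
      _ ≤ ‖g u (e + w)‖ := Real.le_norm_self _
      _ ≤ ‖e + w‖ := (g u).le_of_opNorm_le_of_le (hg1 u) le_rfl |>.trans (by simp)
  have h2 : ‖e‖ * (1 / 2) < g u e := by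
    rwa [inv_mul_eq_div, lt_div_iff₀ hpos, mul_comm] at hu'
  linarith

/-- Without nontrivial infratype there is a sequence of uniform copies of `ℓ₁ᴺ` of growing
dimension that together form a finite-dimensional decomposition of their span. -/
lemma exists_seq_l1_families {X : Type*} [NormedAddCommGroup X] [NormedSpace ℝ X]
    (hX : ∀ p C : ℝ, 1 < p → 0 < C → ¬ HasInfratype X p C) :
    ∃ (n : ℕ → ℕ) (x : ℕ → ℕ → X), StrictMono n ∧ (∀ k, 0 < n k) ∧ (∀ k i, ‖x k i‖ ≤ 1) ∧
      (∀ k (c : ℕ → ℝ), ∑ i ∈ Finset.range (2 * n k), |c i| ≤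
        2 * ‖∑ i ∈ Finset.range (2 * n k), c i • x k i‖) ∧
      ∀ k, ∃ E W : Submodule ℝ X, (∀ j ≤ k, ∀ i < 2 * n j, x j i ∈ E) ∧
        (∀ j > k, ∀ i, x j i ∈ W) ∧ ∀ e ∈ E, ∀ w ∈ W, ‖e‖ ≤ 2 * ‖e + w‖ := by
  classical
  let P : ℕ × (ℕ → X) × Submodule ℝ X × Finset (X →L[ℝ] ℝ) → Prop := fun a =>
    0 < a.1 ∧ (∀ i, ‖a.2.1 i‖ ≤ 1) ∧
    (∀ c : ℕ → ℝ, ∑ i ∈ Finset.range (2 * a.1), |c i| ≤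
        2 * ‖∑ i ∈ Finset.range (2 * a.1), c i • a.2.1 i‖) ∧
    (∀ i < 2 * a.1, a.2.1 i ∈ a.2.2.1) ∧ FiniteDimensional ℝ a.2.2.1 ∧
    ∀ e ∈ a.2.2.1, ∀ w, (∀ f ∈ a.2.2.2, f w = 0) → ‖e‖ ≤ 2 * ‖e + w‖
  obtain ⟨a, haP, har⟩ := exists_seq_of_forall_finset_exists P
    (fun a b => a.1 < b.1 ∧ a.2.2.1 ≤ b.2.2.1 ∧ ∀ f ∈ a.2.2.2, ∀ i, f (b.2.1 i) = 0) (by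
      intro s hs
      set m := s.sup Prod.fst + 1 with hm
      obtain ⟨x, hx1, hxΦ, hxl⟩ := exists_l1_family hX (s.biUnion fun a => a.2.2.2)
        (N := 2 * m) (by omega)
      let E : Submodule ℝ X := (⨆ a : s, a.1.2.2.1) ⊔
        Submodule.span ℝ ((Finset.range (2 * m)).image x : Finset X)
      have hfd : ∀ a : s, FiniteDimensional ℝ a.1.2.2.1 := fun a => (hs a a.2).2.2.2.2.1
      have hE : FiniteDimensional ℝ E := by
        have h1 : FiniteDimensional ℝ (⨆ a : s, a.1.2.2.1 : Submodule ℝ X) :=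
          Submodule.finiteDimensional_iSup _
        exact Submodule.finiteDimensional_sup _ _
      obtain ⟨Φ, hΦ⟩ := exists_finset_dual_norm_le_two_mul E
      refine ⟨(m, x, E, Φ), ⟨by omega, hx1, hxl, fun i hi => ?_, hE, hΦ⟩, fun b hb =>
        ⟨?_, ?_, fun f hf i => hxΦ f (Finset.mem_biUnion.2 ⟨b, hb, hf⟩) i⟩⟩
      · refine Submodule.mem_sup_right (Submodule.subset_span ?_)
        exact Finset.mem_coe.2 (Finset.mem_image_of_mem _ (Finset.mem_range.2 hi))
      · exact Nat.lt_succ_of_le (Finset.le_sup (f := Prod.fst) hb)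
      · exact (le_iSup (fun a : s => a.1.2.2.1) ⟨b, hb⟩).trans le_sup_left)
  refine ⟨fun k => (a k).1, fun k => (a k).2.1, fun i j hij => (har i j hij).1,
    fun k => (haP k).1, fun k => (haP k).2.1, fun k => (haP k).2.2.1, fun k =>
    ⟨(a k).2.2.1, ⨅ f ∈ (a k).2.2.2, LinearMap.ker (f : X →L[ℝ] ℝ).toLinearMap, ?_, ?_, ?_⟩⟩
  · intro j hj i hi
    have hmem := (haP j).2.2.2.1 i hi
    rcases hj.eq_or_lt with rfl | hlt
    exacts [hmem, (har j k hlt).2.1 hmem]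
  · intro j hj i
    simp only [Submodule.mem_iInf, LinearMap.mem_ker]
    exact fun f hf => (har k j hj).2.2 f hf i
  · intro e he w hw
    simp only [Submodule.mem_iInf, LinearMap.mem_ker] at hw
    exact (haP k).2.2.2.2.2 e he w hw

lemma one_le_norm_sub_average {X : Type*} [NormedAddCommGroup X] [NormedSpace ℝ X]
    {m k : ℕ} (hm : 0 < m) (x : ℕ → ℕ → X) (E E' W W' : Submodule ℝ X)
    (hl1 : ∀ c : ℕ → ℝ, ∑ i ∈ Finset.range (2 * m), |c i| ≤
      2 * ‖∑ i ∈ Finset.range (2 * m), c i • x k i‖)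
    (hEW : ∀ e ∈ E, ∀ w ∈ W, ‖e‖ ≤ 2 * ‖e + w‖) (hEW' : ∀ e ∈ E', ∀ w ∈ W', ‖e‖ ≤ 2 * ‖e + w‖)
    (hkE' : ∀ i < 2 * m, x k i ∈ E') (hkW : ∀ i, x k i ∈ W) (hE : E ≤ E')
    (j l : Fin m → ℕ) (hlt : ∀ i, j i < k → x (j i) (l i) ∈ E)
    (heq : ∀ i, j i = k → l i < 2 * m) (hgt : ∀ i, k < j i → x (j i) (l i) ∈ W') :
    1 / 24 ≤ ‖∑ i ∈ Finset.range (2 * m), (1 / (2 * m : ℝ)) • x k i -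
      ∑ i, (1 / m : ℝ) • x (j i) (l i)‖ := by
  classical
  have hm' : (0 : ℝ) < m := by exact_mod_cast hm
  set b := ∑ i ∈ Finset.range (2 * m), (1 / (2 * m : ℝ)) • x k i with hb
  set v : Fin m → X := fun i => (1 / m : ℝ) • x (j i) (l i) with hv
  set S : Finset (Fin m) := Finset.univ.filter fun i => j i = k with hS
  set A := ∑ i with j i < k, v i with hA
  set B := ∑ i ∈ S, v i with hB
  set C := ∑ i with k < j i, v i with hC
  have hsum : ∑ i, v i = A + B + C := by
    rw [hA, hB, hC, hS, Finset.sum_filter, Finset.sum_filter, Finset.sum_filter,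
      ← Finset.sum_add_distrib, ← Finset.sum_add_distrib]
    refine Finset.sum_congr rfl fun i _ => ?_
    rcases lt_trichotomy (j i) k with h | h | h
    · simp [h, h.ne, h.le]
    · simp [h]
    · simp [h, h.ne', h.le]
  let c : ℕ → ℝ := fun q => 1 / (2 * m) - ∑ i ∈ S with l i = q, 1 / (m : ℝ)
  have hbB : b - B = ∑ q ∈ Finset.range (2 * m), c q • x k q := by
    have hBf : B = ∑ q ∈ Finset.range (2 * m), ∑ i ∈ S with l i = q, v i :=
      (Finset.sum_fiberwise_of_maps_to (fun i hi =>
        Finset.mem_range.2 (heq i (Finset.mem_filter.1 hi).2)) _).symm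
    rw [hBf, hb, ← Finset.sum_sub_distrib]
    refine Finset.sum_congr rfl fun q _ => ?_
    rw [sub_smul, Finset.sum_smul]
    congr 1
    refine Finset.sum_congr rfl fun i hi => ?_
    simp only [hS, Finset.mem_filter, Finset.mem_univ, true_and] at hi
    simp only [hv, hi.1, hi.2]
  have hc : 1 / 2 ≤ ∑ q ∈ Finset.range (2 * m), |c q| := by
    set U := Finset.range (2 * m) \ Finset.univ.image l with hU
    have hcard : m ≤ U.card := by
      have h1 : (Finset.range (2 * m)).card - (Finset.univ.image l).card ≤ U.card :=
        Finset.le_card_sdiff _ _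
      have h2 : (Finset.univ.image l).card ≤ m := Finset.card_image_le.trans (by simp)
      rw [Finset.card_range] at h1
      omega
    calc (1 / 2 : ℝ) = m * (1 / (2 * m)) := by field_simp
      _ ≤ U.card * (1 / (2 * m)) := by gcongr
      _ = ∑ q ∈ U, |c q| := by
          rw [← nsmul_eq_mul, ← Finset.sum_const]
          refine Finset.sum_congr rfl fun q hq => ?_
          have hempty : (S.filter fun i => l i = q) = ∅ := by
            refine Finset.filter_eq_empty_iff.2 fun i _ hiq => ?_
            refine (Finset.mem_sdiff.1 hq).2 ?_
            exact hiq ▸ Finset.mem_image_of_mem l (Finset.mem_univ i)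
          simp only [c, hempty, Finset.sum_empty, sub_zero]
          exact (abs_of_pos (by positivity)).symm
      _ ≤ _ := Finset.sum_le_sum_of_subset_of_nonneg Finset.sdiff_subset fun _ _ _ => abs_nonneg _
  have hlow : 1 / 4 ≤ ‖b - B‖ := by
    have := hl1 c
    rw [← hbB] at this
    linarith
  have hAE : A ∈ E := Submodule.sum_mem _ fun i hi =>
    E.smul_mem _ (hlt i (Finset.mem_filter.1 hi).2)
  have hCW : C ∈ W' := Submodule.sum_mem _ fun i hi =>
    W'.smul_mem _ (hgt i (Finset.mem_filter.1 hi).2)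
  have hbBW : b - B ∈ W := hbB ▸ Submodule.sum_mem _ fun q _ => W.smul_mem _ (hkW q)
  have hbBE : b - B ∈ E' := hbB ▸ Submodule.sum_mem _ fun q hq =>
    E'.smul_mem _ (hkE' q (Finset.mem_range.1 hq))
  have h1 := hEW (-A) (E.neg_mem hAE) (b - B) hbBW
  have h2 := hEW' (-A + (b - B)) (E'.add_mem (E'.neg_mem (hE hAE)) hbBE) (-C) (W'.neg_mem hCW)
  have h3 : ‖b - B‖ ≤ ‖-A + (b - B)‖ + ‖-A‖ := by
    have := norm_sub_le (-A + (b - B)) (-A)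
    rwa [add_sub_cancel_left] at this
  have h4 : -A + (b - B) + -C = b - ∑ i, v i := by
    rw [hsum]
    abel
  rw [h4] at h2
  linarith

/-- The partition of `[0,1]` into `n` intervals of equal length, tagged by left endpoints. -/
noncomputable def equalPartition (n : ℕ) (hn : 0 < n) : TaggedPartition where
  n := n
  npos := hn
  x i := (i : ℕ) / n
  t i := (i : ℕ) / n
  mono i j hij := by
    have : ((i : ℕ) : ℝ) ≤ (j : ℕ) := by exact_mod_cast hij
    dsimp only
    gcongr
  x_zero := by simp
  x_last := by
    have : (n : ℝ) ≠ 0 := by exact_mod_cast hn.ne'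
    simp [this]
  tag_mem i := by
    simp only [Fin.val_castSucc, Fin.val_succ, Set.mem_Icc, le_refl, true_and]
    push_cast
    gcongr
    linarith

lemma equalPartition_length (n : ℕ) (hn : 0 < n) (i : Fin (equalPartition n hn).n) :
    (equalPartition n hn).x i.succ - (equalPartition n hn).x i.castSucc = 1 / n := by
  have h : ∀ j : Fin n, ((j.succ : ℕ) : ℝ) / n - ((j.castSucc : ℕ) : ℝ) / n = 1 / n := fun j => by
    simp only [Fin.val_succ, Fin.val_castSucc]
    push_cast
    ring
  exact h i

lemma mesh_equalPartition (n : ℕ) (hn : 0 < n) : (equalPartition n hn).mesh = 1 / n := by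
  have : Nonempty (Fin (equalPartition n hn).n) := ⟨⟨0, hn⟩⟩
  unfold TaggedPartition.mesh
  exact (iSup_congr (equalPartition_length n hn)).trans ciSup_const

lemma mem_setRiemannSum_equalPartition {X : Type*} [NormedAddCommGroup X] [NormedSpace ℝ X]
    (K : Set X) (n : ℕ) (hn : 0 < n) (y : X) :
    y ∈ setRiemannSum (fun _ => K) (equalPartition n hn) ↔
      ∃ g : Fin n → X, (∀ i, g i ∈ K) ∧ ∑ i, (1 / n : ℝ) • g i = y := by
  have h : setRiemannSum (fun _ => K) (equalPartition n hn) = ∑ _i : Fin n, (1 / n : ℝ) • K :=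
    Finset.sum_congr rfl fun i _ => congrArg (· • K) (equalPartition_length n hn i)
  rw [h, Set.mem_fintype_sum]
  constructor
  · rintro ⟨g, hg, rfl⟩
    choose f hf hfg using hg
    exact ⟨f, hf, Finset.sum_congr rfl fun i _ => hfg i⟩
  · rintro ⟨g, hg, rfl⟩
    exact ⟨fun i => (1 / n : ℝ) • g i, fun i => Set.smul_mem_smul_set (hg i), rfl⟩

lemma sum_smul_set_eq_of_convex {X ι : Type*} [NormedAddCommGroup X] [NormedSpace ℝ X]
    {C : Set X} (hC : Convex ℝ C) (hne : C.Nonempty) (s : Finset ι) (w : ι → ℝ)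
    (hw : ∀ i ∈ s, 0 ≤ w i) : ∑ i ∈ s, w i • C = (∑ i ∈ s, w i) • C := by
  classical
  induction s using Finset.induction_on with
  | empty => simp [Set.zero_smul_set hne]
  | insert a s ha ih =>
    rw [Finset.forall_mem_insert] at hw
    rw [Finset.sum_insert ha, Finset.sum_insert ha, ih hw.2,
      hC.add_smul hw.1 (Finset.sum_nonneg hw.2)]

lemma setRiemannSum_const_of_convex {X : Type*} [NormedAddCommGroup X] [NormedSpace ℝ X]
    {C : Set X} (hC : Convex ℝ C) (hne : C.Nonempty) (T : TaggedPartition) :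
    setRiemannSum (fun _ => C) T = C := by
  have hsum : ∑ i : Fin T.n, (T.x i.succ - T.x i.castSucc) = 1 := by
    rw [Finset.sum_sub_distrib, sub_eq_iff_eq_add, ← T.x_last]
    have h1 := Fin.sum_univ_succ T.x
    have h2 := Fin.sum_univ_castSucc T.x
    rw [T.x_zero] at h1
    linarith
  unfold setRiemannSum
  rw [sum_smul_set_eq_of_convex hC hne _ _ fun i _ =>
    sub_nonneg.2 (T.mono i.castSucc_lt_succ.le), hsum, one_smul]

lemma setRiemannIntegrable_convexHull_const {X : Type*} [NormedAddCommGroup X] [NormedSpace ℝ X]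
    {K : Set X} (hne : K.Nonempty) (hb : Bornology.IsBounded K) :
    SetRiemannIntegrable fun _ => convexHull ℝ K := by
  refine ⟨closure (convexHull ℝ K), hne.convexHull.closure, isClosed_closure,
    (isBounded_convexHull.2 hb).closure, fun ε hε => ⟨1, one_pos, fun T _ => ?_⟩⟩
  rw [setRiemannSum_const_of_convex (convex_convexHull ℝ K) hne.convexHull]
  simpa using hε

/-- If a constant multifunction with value `K` is integrable, then averages of `n` elements of `K`
come uniformly close, for large `n`, to every average of elements of `K`. -/
lemma exists_average_dist_lt_of_integrable {X : Type*} [NormedAddCommGroup X] [NormedSpace ℝ X]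
    {K : Set X} (hne : K.Nonempty) (hK : ∀ v ∈ K, ‖v‖ ≤ 1)
    (hint : SetRiemannIntegrable fun _ => K) {ε : ℝ} (hε : 0 < ε) :
    ∃ n₀ : ℕ, ∀ n > n₀, ∀ N > 0, ∀ u : Fin N → X, (∀ i, u i ∈ K) →
      ∃ g : Fin n → X, (∀ i, g i ∈ K) ∧
        ‖∑ i, (1 / N : ℝ) • u i - ∑ i, (1 / n : ℝ) • g i‖ < ε := by
  obtain ⟨A, hAne, hAc, hAb, hA⟩ := hint
  have hfin : ∀ n (hn : 0 < n), Metric.hausdorffEDist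
      (setRiemannSum (fun _ => K) (equalPartition n hn)) A ≠ ⊤ := by
    intro n hn
    have hn' : (n : ℝ) ≠ 0 := by exact_mod_cast hn.ne'
    obtain ⟨v, hv⟩ := hne
    refine Metric.hausdorffEDist_ne_top_of_nonempty_of_bounded
      ⟨_, (mem_setRiemannSum_equalPartition K n hn _).2 ⟨fun _ => v, fun _ => hv, rfl⟩⟩ hAne
      ((Metric.isBounded_closedBall (x := (0 : X)) (r := 1)).subset fun y hy => ?_) hAb
    obtain ⟨g, hg, rfl⟩ := (mem_setRiemannSum_equalPartition K n hn y).1 hy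
    rw [mem_closedBall_zero_iff]
    calc ‖∑ i, (1 / n : ℝ) • g i‖ ≤ ∑ _i : Fin n, (1 / n : ℝ) := by
          refine norm_sum_le_of_le _ fun i _ => ?_
          rw [norm_smul, Real.norm_of_nonneg (by positivity)]
          exact mul_le_of_le_one_right (by positivity) (hK _ (hg i))
      _ = 1 := by simp [hn']
  have hmesh : ∀ {δ : ℝ}, 0 < δ → ∃ n₀ : ℕ, ∀ n > n₀, ∀ hn : 0 < n,
      (equalPartition n hn).mesh < δ := by
    intro δ hδ
    obtain ⟨n₀, hn₀⟩ := exists_nat_gt (1 / δ)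
    refine ⟨n₀, fun n hnn hn => ?_⟩
    rw [mesh_equalPartition, div_lt_comm₀ (by exact_mod_cast hn) hδ]
    exact hn₀.trans (by exact_mod_cast hnn)
  have havg : ∀ N > 0, ∀ u : Fin N → X, (∀ i, u i ∈ K) → ∑ i, (1 / N : ℝ) • u i ∈ A := by
    intro N hN u hu
    rw [← hAc.closure_eq, Metric.mem_closure_iff]
    intro η hη
    obtain ⟨δ, hδ, hT⟩ := hA η hη
    obtain ⟨q, hq⟩ := hmesh hδ
    have hpos : 0 < N * (q + 1) := by positivity
    refine Metric.exists_dist_lt_of_hausdorffDist_lt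
      ((mem_setRiemannSum_equalPartition K (N * (q + 1)) hpos _).2
        ⟨fun i => u (finProdFinEquiv.symm i).1, fun i => hu _, ?_⟩)
      (hT _ (hq _ (by nlinarith) hpos)) (hfin _ hpos)
    rw [← finProdFinEquiv.sum_comp]
    simp only [Equiv.symm_apply_apply, Fintype.sum_prod_type, Finset.sum_const, Finset.card_univ,
      Fintype.card_fin]
    refine Finset.sum_congr rfl fun i _ => ?_
    rw [← Nat.cast_smul_eq_nsmul ℝ, smul_smul]
    congr 1
    push_cast
    field_simp
  obtain ⟨δ, hδ, hT⟩ := hA ε hε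
  obtain ⟨n₀, hn₀⟩ := hmesh hδ
  refine ⟨n₀, fun n hn N hN u hu => ?_⟩
  have hn0 : 0 < n := by omega
  obtain ⟨s, hs, hdist⟩ := Metric.exists_dist_lt_of_hausdorffDist_lt' (havg N hN u hu)
    (hT _ (hn₀ n hn hn0)) (hfin n hn0)
  obtain ⟨g, hg, rfl⟩ := (mem_setRiemannSum_equalPartition K n hn0 s).1 hs
  exact ⟨g, hg, by rwa [← dist_eq_norm, dist_comm]⟩

/-- In a Banach space without nontrivial infratype there is a multifunction `F` whose convex
hull is Riemann integrable while `F` itself is not. -/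
theorem stmt13 {X : Type*} [NormedAddCommGroup X] [NormedSpace ℝ X] [CompleteSpace X]
    (hX : ∀ p C : ℝ, 1 < p → 0 < C → ¬ HasInfratype X p C) :
    ∃ F : ℝ → Set X, IsMultifunction F ∧
      SetRiemannIntegrable (fun t => convexHull ℝ (F t)) ∧ ¬ SetRiemannIntegrable F := by
  obtain ⟨n, x, hn, hn0, hx1, hl1, hEW⟩ := exists_seq_l1_families hX
  choose E W hE hW hEW using hEW
  let K : Set X := {v | ∃ j i, i < 2 * n j ∧ x j i = v}
  have hKne : K.Nonempty := ⟨x 0 0, 0, 0, by have := hn0 0; omega, rfl⟩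
  have hK1 : ∀ v ∈ K, ‖v‖ ≤ 1 := by
    rintro v ⟨j, i, -, rfl⟩
    exact hx1 j i
  have hKb : Bornology.IsBounded K := isBounded_iff_forall_norm_le.2 ⟨1, hK1⟩
  refine ⟨fun _ => K, fun t _ => ⟨hKne, hKb⟩, setRiemannIntegrable_convexHull_const hKne hKb,
    fun hint => ?_⟩
  obtain ⟨k, hk⟩ := exists_average_dist_lt_of_integrable hKne hK1 hint (ε := 1 / 24) (by norm_num)
  obtain ⟨g, hg, hlt⟩ := hk (n (k + 1)) (Nat.lt_of_succ_le (hn.le_apply)) (2 * n (k + 1))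
    (by have := hn0 (k + 1); omega) (fun i => x (k + 1) i) fun i => ⟨k + 1, i, i.2, rfl⟩
  choose j l hl hjl using hg
  refine (one_le_norm_sub_average (hn0 (k + 1)) x
    (Submodule.span ℝ {v | ∃ j ≤ k, ∃ i < 2 * n j, x j i = v})
    (E (k + 1)) (W k) (W (k + 1)) (hl1 (k + 1)) (fun e he => hEW k e ?_) (hEW (k + 1))
    (hE (k + 1) (k + 1) le_rfl) (hW k (k + 1) (Nat.lt_succ_self k)) ?_ j l ?_ ?_ ?_).not_gt ?_
  · refine Submodule.span_le.2 ?_ he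
    rintro v ⟨j, hj, i, hi, rfl⟩
    exact hE k j hj i hi
  · refine Submodule.span_le.2 ?_
    rintro v ⟨j, hj, i, hi, rfl⟩
    exact hE (k + 1) j (by omega) i hi
  · exact fun i hi => Submodule.subset_span ⟨j i, by omega, l i, hl i, rfl⟩
  · exact fun i hi => hi ▸ hl i
  · exact fun i hi => hW (k + 1) (j i) hi (l i)
  · rw [Finset.sum_range]
    simpa [hjl] using hlt
end

section
/- Let X be a real Banach space with the approximation property, and let F : [0,1] → (nonempty bounded subsets of X) be a multifunction such that conv F : t ↦ conv(F(t)) is Riemann integrable and its Riemann integral A = ∫₀¹ conv F(t) dt is compact. Then F is Riemann integrable (and ∫₀¹ F(t) dt = A). -/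
open Pointwise

/-- `X` has the approximation property: every compact set can be uniformly approximated by
the image of a finite-rank bounded operator. -/
def HasApproximationProperty (X : Type*) [NormedAddCommGroup X] [NormedSpace ℝ X] : Prop :=
  ∀ A : Set X, IsCompact A → ∀ ε > (0 : ℝ), ∃ P : X →L[ℝ] X,
    FiniteDimensional ℝ (LinearMap.range (P : X →ₗ[ℝ] X)) ∧ ∀ x ∈ A, ‖P x - x‖ < ε

namespace TaggedPartition

/-- The length of the `i`-th subinterval of a tagged partition. -/
def length (T : TaggedPartition) (i : Fin T.n) : ℝ := T.x i.succ - T.x i.castSucc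

theorem length_nonneg (T : TaggedPartition) (i : Fin T.n) : 0 ≤ T.length i :=
  sub_nonneg.2 (T.mono i.castSucc_lt_succ.le)

theorem length_le_mesh (T : TaggedPartition) (i : Fin T.n) : T.length i ≤ T.mesh :=
  le_ciSup (f := fun i : Fin T.n => T.x i.succ - T.x i.castSucc) (Set.finite_range _).bddAbove i

theorem sum_length (T : TaggedPartition) : ∑ i, T.length i = 1 := by
  have h := (Fin.sum_univ_succ T.x).symm.trans (Fin.sum_univ_castSucc T.x)
  rw [T.x_zero, T.x_last] at h
  simp only [length, Finset.sum_sub_distrib]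
  linarith

theorem sum_length_sq_le (T : TaggedPartition) : ∑ i, T.length i ^ 2 ≤ T.mesh := by
  calc ∑ i, T.length i ^ 2 ≤ ∑ i, T.mesh * T.length i := Finset.sum_le_sum fun i _ => by
        rw [sq]
        exact mul_le_mul_of_nonneg_right (T.length_le_mesh i) (T.length_nonneg i)
    _ = T.mesh := by rw [← Finset.mul_sum, T.sum_length, mul_one]

theorem tag_mem_unitInterval (T : TaggedPartition) (i : Fin T.n) : T.t i ∈ Set.Icc (0 : ℝ) 1 :=
  ⟨T.x_zero ▸ (T.mono (Fin.zero_le _)).trans (T.tag_mem i).1,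
    T.x_last ▸ (T.tag_mem i).2.trans (T.mono (Fin.le_last _))⟩

/-- The partition of `[0,1]` into `N` intervals of equal length with prescribed tags. -/
noncomputable def uniform (N : ℕ) (hN : 0 < N) (t : Fin N → ℝ)
    (ht : ∀ i : Fin N, t i ∈ Set.Icc ((i : ℝ) / N) ((i + 1 : ℝ) / N)) : TaggedPartition where
  n := N
  npos := hN
  x i := (i : ℝ) / N
  t := t
  mono i j hij := div_le_div_of_nonneg_right (by exact_mod_cast hij) (Nat.cast_nonneg N)
  x_zero := by simp
  x_last := by simp [hN.ne']
  tag_mem i := by simpa using ht i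

theorem length_uniform (N : ℕ) (hN : 0 < N) (t : Fin N → ℝ)
    (ht : ∀ i : Fin N, t i ∈ Set.Icc ((i : ℝ) / N) ((i + 1 : ℝ) / N)) (i : Fin N) :
    (uniform N hN t ht).length i = 1 / N := by
  change (((i.succ : Fin (N + 1)) : ℕ) : ℝ) / N - (((i.castSucc : Fin (N + 1)) : ℕ) : ℝ) / N = _
  rw [← sub_div]
  simp

theorem mesh_uniform (N : ℕ) (hN : 0 < N) (t : Fin N → ℝ)
    (ht : ∀ i : Fin N, t i ∈ Set.Icc ((i : ℝ) / N) ((i + 1 : ℝ) / N)) :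
    (uniform N hN t ht).mesh = 1 / N := by
  have : Nonempty (Fin N) := ⟨⟨0, hN⟩⟩
  calc (uniform N hN t ht).mesh = ⨆ i : Fin N, (uniform N hN t ht).length i := rfl
    _ = 1 / N := by simp_rw [length_uniform, ciSup_const]

end TaggedPartition

section RiemannSum

variable {X : Type*} [NormedAddCommGroup X] [NormedSpace ℝ X]

theorem mem_setRiemannSum {F : ℝ → Set X} {T : TaggedPartition} {y : X} :
    y ∈ setRiemannSum F T ↔
      ∃ f : Fin T.n → X, (∀ i, f i ∈ F (T.t i)) ∧ ∑ i, T.length i • f i = y := by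
  simp only [setRiemannSum, Set.mem_fintype_sum, Set.mem_smul_set]
  constructor
  · rintro ⟨g, hg, rfl⟩
    choose f hf hfg using hg
    exact ⟨f, hf, Finset.sum_congr rfl fun i _ => hfg i⟩
  · rintro ⟨f, hf, rfl⟩
    exact ⟨fun i => T.length i • f i, fun i => ⟨f i, hf i, rfl⟩, rfl⟩

theorem setRiemannSum_mono {F G : ℝ → Set X} (h : ∀ t, F t ⊆ G t) (T : TaggedPartition) :
    setRiemannSum F T ⊆ setRiemannSum G T := by
  intro y hy
  obtain ⟨f, hf, hy⟩ := mem_setRiemannSum.1 hy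
  exact mem_setRiemannSum.2 ⟨f, fun i => h _ (hf i), hy⟩

theorem IsMultifunction.convexHull {F : ℝ → Set X} (hF : IsMultifunction F) :
    IsMultifunction fun t => convexHull ℝ (F t) := fun t ht =>
  ⟨(hF t ht).1.convexHull, isBounded_convexHull.2 (hF t ht).2⟩

theorem IsMultifunction.nonempty_setRiemannSum {F : ℝ → Set X} (hF : IsMultifunction F)
    (T : TaggedPartition) : (setRiemannSum F T).Nonempty := by
  choose f hf using fun i => (hF _ (T.tag_mem_unitInterval i)).1
  exact ⟨_, mem_setRiemannSum.2 ⟨f, hf, rfl⟩⟩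

theorem IsMultifunction.isBounded_setRiemannSum {F : ℝ → Set X} (hF : IsMultifunction F)
    (T : TaggedPartition) : Bornology.IsBounded (setRiemannSum F T) := by
  choose C hC using fun i => (hF _ (T.tag_mem_unitInterval i)).2.exists_norm_le
  refine isBounded_iff_forall_norm_le.2 ⟨∑ i, T.length i * C i, fun y hy => ?_⟩
  obtain ⟨f, hf, rfl⟩ := mem_setRiemannSum.1 hy
  refine norm_sum_le_of_le _ fun i _ => ?_
  rw [norm_smul, Real.norm_of_nonneg (T.length_nonneg i)]
  exact mul_le_mul_of_nonneg_left (hC i _ (hf i)) (T.length_nonneg i)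

theorem IsMultifunction.hausdorffEDist_setRiemannSum_ne_top {F : ℝ → Set X}
    (hF : IsMultifunction F) (T : TaggedPartition) {A : Set X} (hA : A.Nonempty)
    (hA' : Bornology.IsBounded A) : Metric.hausdorffEDist (setRiemannSum F T) A ≠ ⊤ :=
  Metric.hausdorffEDist_ne_top_of_nonempty_of_bounded (hF.nonempty_setRiemannSum T) hA
    (hF.isBounded_setRiemannSum T) hA'

/-- A Riemann integrable multifunction is uniformly bounded on `[0,1]`. -/
theorem IsSetRiemannIntegral.exists_norm_le {F : ℝ → Set X} (hF : IsMultifunction F) {A : Set X}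
    (hFA : IsSetRiemannIntegral F A) :
    ∃ M, ∀ t ∈ Set.Icc (0 : ℝ) 1, ∀ f ∈ F t, ‖f‖ ≤ M := by
  obtain ⟨hA, -, hAb, hlim⟩ := hFA
  obtain ⟨δ, hδ, hT⟩ := hlim 1 one_pos
  obtain ⟨m, hm⟩ := exists_nat_one_div_lt hδ
  obtain ⟨R, hR⟩ := hAb.exists_norm_le
  set N : ℕ := m + 1 with hNdef
  have hN : 0 < N := m.succ_pos
  have hN' : (0 : ℝ) < N := Nat.cast_pos.2 hN
  have hbase : ∀ i : Fin N, ((i : ℝ) / N) ∈ Set.Icc ((i : ℝ) / N) ((i + 1 : ℝ) / N) := fun i =>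
    ⟨le_rfl, div_le_div_of_nonneg_right (by linarith) hN'.le⟩
  have hbase01 : ∀ i : Fin N, ((i : ℝ) / N) ∈ Set.Icc (0 : ℝ) 1 := fun i =>
    ⟨by positivity, (div_le_one hN').2 (by exact_mod_cast i.2.le)⟩
  choose s hs using fun i => (hF _ (hbase01 i)).1
  refine ⟨N * (R + 1) + ∑ i, ‖s i‖, fun t ht f hf => ?_⟩
  obtain ⟨j, hj⟩ : ∃ j : Fin N, t ∈ Set.Icc ((j : ℝ) / N) ((j + 1 : ℝ) / N) := by
    rcases ht.2.lt_or_eq with h1 | rfl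
    · have h0 : 0 ≤ t * N := mul_nonneg ht.1 hN'.le
      refine ⟨⟨⌊t * N⌋₊, (Nat.floor_lt h0).2 (by nlinarith)⟩, ?_, ?_⟩
      · exact (div_le_iff₀ hN').2 (Nat.floor_le h0)
      · exact (le_div_iff₀ hN').2 (Nat.lt_floor_add_one _).le
    · refine ⟨⟨m, m.lt_succ_self⟩, ?_, ?_⟩
      · rw [div_le_one hN']
        simp [hNdef]
      · rw [le_div_iff₀ hN']
        simp [hNdef]
  let u : Fin N → ℝ := Function.update (fun i => (i : ℝ) / N) j t
  let g : Fin N → X := Function.update s j f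
  have hu : ∀ i : Fin N, u i ∈ Set.Icc ((i : ℝ) / N) ((i + 1 : ℝ) / N) := by
    intro i
    by_cases hij : i = j
    · subst hij
      simpa [u] using hj
    · simpa [u, hij] using hbase i
  have hg : ∀ i, g i ∈ F (u i) := by
    intro i
    by_cases hij : i = j
    · subst hij
      simpa [u, g] using hf
    · simpa [u, g, hij] using hs i
  let T := TaggedPartition.uniform N hN u hu
  have hmesh : T.mesh < δ := by
    rw [TaggedPartition.mesh_uniform]
    simpa [hNdef] using hm
  have hmem : ∑ i : Fin N, (1 / N : ℝ) • g i ∈ setRiemannSum F T :=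
    mem_setRiemannSum.2 ⟨g, hg, Finset.sum_congr rfl fun (i : Fin N) _ =>
      congrArg (· • g i) (TaggedPartition.length_uniform N hN u hu i)⟩
  obtain ⟨a, ha, hda⟩ := Metric.exists_dist_lt_of_hausdorffDist_lt hmem (hT T hmesh)
    (hF.hausdorffEDist_setRiemannSum_ne_top T hA hAb)
  have hsum : ‖∑ i, g i‖ ≤ N * (R + 1) := by
    rw [← Finset.smul_sum, dist_eq_norm] at hda
    have h1 : ‖(1 / N : ℝ) • ∑ i, g i‖ ≤ R + 1 := by
      have := norm_le_norm_add_norm_sub a ((1 / N : ℝ) • ∑ i, g i)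
      rw [norm_sub_rev] at this
      linarith [hR a ha, norm_sub_rev a ((1 / N : ℝ) • ∑ i, g i)]
    rw [norm_smul, Real.norm_of_nonneg (by positivity), one_div, inv_mul_le_iff₀ hN'] at h1
    exact h1
  have hsplit : f = ∑ i, g i - ∑ i ∈ Finset.univ.erase j, s i := by
    rw [← Finset.add_sum_erase _ g (Finset.mem_univ j), eq_sub_iff_add_eq]
    congr 1
    · simp [g]
    · refine Finset.sum_congr rfl fun i hi => ?_
      simp [g, Finset.ne_of_mem_erase hi]
  calc ‖f‖ ≤ ‖∑ i, g i‖ + ‖∑ i ∈ Finset.univ.erase j, s i‖ := by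
        conv_lhs => rw [hsplit]
        exact norm_sub_le _ _
    _ ≤ N * (R + 1) + ∑ i, ‖s i‖ := add_le_add hsum <| (norm_sum_le _ _).trans <|
        Finset.sum_le_sum_of_subset_of_nonneg (Finset.erase_subset _ _)
          fun _ _ _ => norm_nonneg _

end RiemannSum

section Selection

variable {X : Type*} [AddCommGroup X] [Module ℝ X]

theorem exists_mem_le_of_mem_convexHull (φ : X →ₗ[ℝ] ℝ) {s : Set X} {z : X}
    (hz : z ∈ convexHull ℝ s) : ∃ y ∈ s, φ y ≤ φ z := by
  by_contra! h
  have hlt : φ z < φ z := convexHull_min h (convex_halfSpace_gt φ.isLinear (φ z)) hz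
  exact hlt.false

/-- A quantitative Shapley–Folkman type statement in an inner product space: points of the convex
hulls may be replaced by points of the sets so that the total error is of the size expected from
orthogonal summands. -/
theorem exists_selection_norm_sum_sq_le {E : Type*} [NormedAddCommGroup E]
    [InnerProductSpace ℝ E] (Q : X →ₗ[ℝ] E) {ι : Type*} (I : Finset ι) (w : ι → ℝ)
    (hw : ∀ i, 0 ≤ w i) (s : ι → Set X) (z : ι → X) (hz : ∀ i, z i ∈ convexHull ℝ (s i)) (C : ℝ)
    (hC : ∀ i, ∀ y ∈ s i, ‖Q y - Q (z i)‖ ≤ C) :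
    ∃ f : ι → X, (∀ i, f i ∈ s i) ∧
      ‖∑ i ∈ I, w i • (Q (f i) - Q (z i))‖ ^ 2 ≤ (∑ i ∈ I, w i ^ 2) * C ^ 2 := by
  classical
  induction I using Finset.induction_on with
  | empty =>
    choose f hf using fun i => convexHull_nonempty_iff.1 ⟨z i, hz i⟩
    exact ⟨f, hf, by simp⟩
  | insert j I hj ih =>
    obtain ⟨f, hf, hle⟩ := ih
    set e := ∑ i ∈ I, w i • (Q (f i) - Q (z i))
    obtain ⟨y, hy, hyz⟩ := exists_mem_le_of_mem_convexHull ((innerₗ E e).comp Q) (hz j)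
    refine ⟨Function.update f j y, fun i => ?_, ?_⟩
    · by_cases hij : i = j
      · subst hij
        simpa using hy
      · simpa [hij] using hf i
    · have hsum : ∑ i ∈ I, w i • (Q (Function.update f j y i) - Q (z i)) = e :=
        Finset.sum_congr rfl fun i hi => by
          rw [Function.update_of_ne (ne_of_mem_of_not_mem hi hj)]
      rw [Finset.sum_insert hj, Finset.sum_insert hj, hsum, Function.update_self, add_comm,
        norm_add_sq_real, inner_smul_right, norm_smul, mul_pow, Real.norm_eq_abs, sq_abs,
        inner_sub_right]
      simp only [LinearMap.comp_apply, innerₗ_apply_apply] at hyz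
      have h1 : w j * (inner ℝ e (Q y) - inner ℝ e (Q (z j))) ≤ 0 :=
        mul_nonpos_of_nonneg_of_nonpos (hw j) (sub_nonpos.2 hyz)
      have h2 : w j ^ 2 * ‖Q y - Q (z j)‖ ^ 2 ≤ w j ^ 2 * C ^ 2 :=
        mul_le_mul_of_nonneg_left (pow_le_pow_left₀ (norm_nonneg _) (hC j y hy) 2) (sq_nonneg _)
      linarith

end Selection

/-- A continuous linear map with finite-dimensional range factors through a Euclidean space. -/
theorem ContinuousLinearMap.exists_eq_comp_euclideanSpace {X Y : Type*} [NormedAddCommGroup X]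
    [NormedSpace ℝ X] [NormedAddCommGroup Y] [NormedSpace ℝ Y] (P : X →L[ℝ] Y)
    (hP : FiniteDimensional ℝ (LinearMap.range (P : X →ₗ[ℝ] Y))) :
    ∃ (n : ℕ) (Q : X →L[ℝ] EuclideanSpace ℝ (Fin n)) (J : EuclideanSpace ℝ (Fin n) →L[ℝ] Y),
      P = J.comp Q := by
  let R := LinearMap.range (P : X →ₗ[ℝ] Y)
  let φ : R ≃L[ℝ] EuclideanSpace ℝ (Fin (Module.finrank ℝ R)) := toEuclidean
  refine ⟨_, (φ : R →L[ℝ] _).comp (P.codRestrict R fun x => ⟨x, rfl⟩),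
    R.subtypeL.comp (φ.symm : EuclideanSpace ℝ (Fin (Module.finrank ℝ R)) →L[ℝ] R), ?_⟩
  ext x
  simp
  rfl

/-- In a Banach space with the approximation property, if `conv F` is Riemann integrable
with compact integral `A`, then `F` is Riemann integrable (with the same integral `A`). -/
theorem stmt14 {X : Type*} [NormedAddCommGroup X] [NormedSpace ℝ X] [CompleteSpace X]
    (hAP : HasApproximationProperty X)
    (F : ℝ → Set X) (hF : IsMultifunction F) (A : Set X)
    (hFA : IsSetRiemannIntegral (fun t => convexHull ℝ (F t)) A) (hAcomp : IsCompact A) :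
    IsSetRiemannIntegral F A := by
  have hG := hF.convexHull
  obtain ⟨M, hM⟩ := hFA.exists_norm_le hG
  obtain ⟨hA, hAc, hAb, hlim⟩ := hFA
  refine ⟨hA, hAc, hAb, fun ε hε => ?_⟩
  obtain ⟨P, hPfin, hP⟩ := hAP A hAcomp (ε / 8) (by positivity)
  obtain ⟨n, Q, J, hPQ⟩ := P.exists_eq_comp_euclideanSpace hPfin
  set C : ℝ := ‖Q‖ * (M + M)
  set ρ : ℝ := ε / (8 * (‖P‖ + 1)) with hρ
  have hρpos : 0 < ρ := by positivity
  have hρmul : ρ * (‖P‖ + 1) = ε / 8 := by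
    rw [hρ]
    field_simp
  have hPρ : 0 ≤ ‖P‖ * ρ := by positivity
  obtain ⟨δ, hδ, hT⟩ := hlim ρ hρpos
  set η : ℝ := (ε / 8) ^ 2 / ((‖J‖ * C) ^ 2 + 1)
  refine ⟨min δ η, lt_min hδ (by positivity), fun T hmesh => ?_⟩
  have hdist := hT T (hmesh.trans_le (min_le_left _ _))
  have hfin := hG.hausdorffEDist_setRiemannSum_ne_top T hA hAb
  have hnear : ∀ y ∈ setRiemannSum F T, ∃ a ∈ A, dist y a < ρ := fun y hy =>
    Metric.exists_dist_lt_of_hausdorffDist_lt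
      (setRiemannSum_mono (fun t => subset_convexHull ℝ (F t)) T hy) hdist hfin
  refine lt_of_le_of_lt (Metric.hausdorffDist_le_of_mem_dist (r := 3 * ε / 4) (by positivity)
    (fun y hy => ?_) fun a ha => ?_) (by linarith)
  · obtain ⟨a, ha, hya⟩ := hnear y hy
    exact ⟨a, ha, by linarith⟩
  · obtain ⟨z, hz, hza⟩ := Metric.exists_dist_lt_of_hausdorffDist_lt' ha hdist hfin
    obtain ⟨g, hg, rfl⟩ := mem_setRiemannSum.1 hz
    obtain ⟨f, hf, hle⟩ := exists_selection_norm_sum_sq_le Q.toLinearMap Finset.univ T.length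
      T.length_nonneg (fun i => F (T.t i)) g hg C fun i y hy => by
        have ht := T.tag_mem_unitInterval i
        change ‖Q y - Q (g i)‖ ≤ C
        rw [← map_sub]
        refine (Q.le_opNorm _).trans (mul_le_mul_of_nonneg_left ?_ (norm_nonneg _))
        exact (norm_sub_le _ _).trans
          (add_le_add (hM _ ht _ (subset_convexHull ℝ _ hy)) (hM _ ht _ (hg i)))
    set y := ∑ i, T.length i • f i with hy
    set z := ∑ i, T.length i • g i with hz
    have hyS : y ∈ setRiemannSum F T := mem_setRiemannSum.2 ⟨f, hf, rfl⟩
    obtain ⟨b, hb, hyb⟩ := hnear y hyS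
    have hsum : ∑ i, T.length i • (Q.toLinearMap (f i) - Q.toLinearMap (g i)) = Q (y - z) := by
      simp [hy, hz, map_sum, smul_sub]
    rw [hsum] at hle
    have hPyz : ‖P (y - z)‖ ≤ ε / 8 := by
      refine le_of_sq_le_sq ?_ (by positivity)
      calc ‖P (y - z)‖ ^ 2 ≤ (‖J‖ * ‖Q (y - z)‖) ^ 2 := by
            rw [hPQ]
            exact pow_le_pow_left₀ (norm_nonneg _) (J.le_opNorm _) 2
        _ ≤ ‖J‖ ^ 2 * (T.mesh * C ^ 2) := by
            rw [mul_pow]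
            gcongr
            exact hle.trans (mul_le_mul_of_nonneg_right T.sum_length_sq_le (sq_nonneg _))
        _ = T.mesh * (‖J‖ * C) ^ 2 := by ring
        _ ≤ η * ((‖J‖ * C) ^ 2 + 1) := by
            gcongr
            · exact (hmesh.trans_le (min_le_right _ _)).le
            · linarith
        _ = (ε / 8) ^ 2 := div_mul_cancel₀ _ (by positivity)
    have hop : ∀ v : X, ‖v‖ < ρ → ‖P v‖ ≤ ‖P‖ * ρ := fun v hv =>
      (P.le_opNorm v).trans (mul_le_mul_of_nonneg_left hv.le (norm_nonneg _))
    rw [dist_eq_norm] at hyb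
    rw [dist_eq_norm] at hza
    have h1 := hop _ hyb
    have h2 := hop _ hza
    refine ⟨y, hyS, ?_⟩
    rw [dist_comm, dist_eq_norm]
    have hdecomp : y - a = (y - b) - (P b - b) - P (y - b) + P (y - z) + P (z - a) + (P a - a) := by
      simp only [map_sub]
      abel
    have hnorm : ‖y - a‖ ≤ ‖y - b‖ + ‖P b - b‖ + ‖P (y - b)‖ + ‖P (y - z)‖ + ‖P (z - a)‖
        + ‖P a - a‖ := by
      rw [hdecomp]
      refine (norm_add_le _ _).trans (add_le_add_left ?_ _)
      refine (norm_add_le _ _).trans (add_le_add_left ?_ _)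
      refine (norm_add_le _ _).trans (add_le_add_left ?_ _)
      refine (norm_sub_le _ _).trans (add_le_add_left ?_ _)
      exact norm_sub_le _ _
    linarith [hP a ha, hP b hb]
end
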